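/- Let G = (B ∪ W, E) be a finite bipartite graph, B₀ ⊆ B a set of black vertices and W₀ ⊆ W a set of white vertices. Then for the Bipartite Influence scores: (1) Ls(G) ≤ Ls(G \ W₀) + |W₀|; (2) Rs(G) ≥ Rs(G \ B₀) − |B₀|; (3) Ls(G) ≥ Ls(G \ B₀) − |B₀|; (4) Rs(G) ≤ Rs(G \ W₀) + |W₀|, where G \ X denotes the induced subgraph on the vertices not in X. -/

import Mathlib

section Influence

variable {V : Type} [Fintype V] [DecidableEq V]

/-- The closed neighbourhood of `v` inside the position `A`. -/
def closedNbhd (G : SimpleGraph V) [DecidableRel G.Adj] (A : Finset V) (v : V) : Finset V :=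
  insert v (A.filter fun u => G.Adj v u)

/-- The set of vertices removed when `v` is played in the position `A`:
`v` itself, its neighbours in `A`, and every vertex of the same colour as `v`
thereby left isolated. -/
def Rmv (G : SimpleGraph V) [DecidableRel G.Adj] (color : V → Bool)
    (A : Finset V) (v : V) : Finset V :=
  closedNbhd G A v ∪
    A.filter (fun u => color u = color v ∧ ∀ w ∈ A, G.Adj u w → w ∈ closedNbhd G A v)

/-- The isolated vertices of the position `A`. -/
def isoSet (G : SimpleGraph V) [DecidableRel G.Adj] (A : Finset V) : Finset V :=
  A.filter fun u => ∀ w ∈ A, ¬ G.Adj u w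

/-- Score of the Bipartite Influence position `A` with the player `turn` to
move (`true` = Left/black, maximizing; `false` = Right/white, minimizing).
Isolated vertices are immediately removed and credited to their owner
(`+1` per black, `−1` per white), the empty position scores `0`, and otherwise
the player to move picks a vertex of his/her colour `v`, scores `|Rmv(A,v)|`,
and the opponent continues on `A \ Rmv(A,v)`. -/
noncomputable def scoreB (G : SimpleGraph V) [DecidableRel G.Adj] (color : V → Bool)
    (turn : Bool) (A : Finset V) : ℝ :=
  (((isoSet G A).filter fun u => color u = true).card : ℝ)
    - (((isoSet G A).filter fun u => color u = false).card : ℝ)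
    + (if h : ((A \ isoSet G A).filter fun u => color u = turn).Nonempty then
        (if turn then
          ((A \ isoSet G A).filter fun u => color u = turn).attach.sup'
            (Finset.attach_nonempty_iff.mpr h) (fun x =>
              ((Rmv G color (A \ isoSet G A) x.1).card : ℝ) +
                scoreB G color false ((A \ isoSet G A) \ Rmv G color (A \ isoSet G A) x.1))
        else
          ((A \ isoSet G A).filter fun u => color u = turn).attach.inf'
            (Finset.attach_nonempty_iff.mpr h) (fun x =>
              -((Rmv G color (A \ isoSet G A) x.1).card : ℝ) +
                scoreB G color true ((A \ isoSet G A) \ Rmv G color (A \ isoSet G A) x.1)))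
      else 0)
termination_by A.card
decreasing_by
  all_goals {
    have hx : x.1 ∈ A \ isoSet G A := (Finset.mem_filter.mp x.2).1
    have hxA : x.1 ∈ A := (Finset.mem_sdiff.mp hx).1
    have hxr : x.1 ∈ Rmv G color (A \ isoSet G A) x.1 :=
      Finset.mem_union_left _ (Finset.mem_insert_self _ _)
    have hsub : (A \ isoSet G A) \ Rmv G color (A \ isoSet G A) x.1 ⊆ A :=
      (Finset.sdiff_subset).trans (Finset.sdiff_subset)
    have hne : x.1 ∉ (A \ isoSet G A) \ Rmv G color (A \ isoSet G A) x.1 := by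
      intro hmem
      exact (Finset.mem_sdiff.mp hmem).2 hxr
    exact Finset.card_lt_card ⟨hsub, fun hAsub => hne (hAsub hxA)⟩
  }

end Influence

section Influence

variable {V : Type} [Fintype V] [DecidableEq V]

/-- The value of a vertex to its owner: `+1` for black, `-1` for white. -/
def vertexSign (color : V → Bool) (v : V) : ℝ := if color v = true then 1 else -1

/-- The value of the best move available to the player `turn` in a position `X` (and `0` if there
is none), ignoring the contribution of isolated vertices of `X`. -/
noncomputable def bestMoveValue (G : SimpleGraph V) [DecidableRel G.Adj] (color : V → Bool)
    (turn : Bool) (X : Finset V) : ℝ :=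
  if h : (X.filter fun u => color u = turn).Nonempty then
    (if turn then
      (X.filter fun u => color u = turn).attach.sup'
        (Finset.attach_nonempty_iff.mpr h) (fun x =>
          ((Rmv G color X x.1).card : ℝ) + scoreB G color false (X \ Rmv G color X x.1))
    else
      (X.filter fun u => color u = turn).attach.inf'
        (Finset.attach_nonempty_iff.mpr h) (fun x =>
          -((Rmv G color X x.1).card : ℝ) + scoreB G color true (X \ Rmv G color X x.1)))
  else 0

variable (G : SimpleGraph V) [DecidableRel G.Adj] (color : V → Bool)

omit [Fintype V] [DecidableEq V] in
lemma sum_vertexSign (S : Finset V) :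
    ∑ x ∈ S, vertexSign color x =
      ((S.filter fun u => color u = true).card : ℝ)
        - ((S.filter fun u => color u = false).card : ℝ) := by
  unfold vertexSign
  rw [Finset.sum_ite]
  simp
  ring

omit [Fintype V] [DecidableEq V] in
lemma neg_card_le_sum_vertexSign (S : Finset V) :
    -(S.card : ℝ) ≤ ∑ x ∈ S, vertexSign color x := by
  rw [Finset.cast_card, ← Finset.sum_neg_distrib]
  refine Finset.sum_le_sum fun x _ => ?_
  unfold vertexSign
  split <;> norm_num

lemma scoreB_eq (turn : Bool) (A : Finset V) :
    scoreB G color turn A = ∑ x ∈ isoSet G A, vertexSign color x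
      + bestMoveValue G color turn (A \ isoSet G A) := by
  rw [scoreB, sum_vertexSign]
  rfl

variable {G color}

lemma mem_isoSet {A : Finset V} {u : V} :
    u ∈ isoSet G A ↔ u ∈ A ∧ ∀ w ∈ A, ¬ G.Adj u w := by
  simp [isoSet]

omit [Fintype V] in
lemma mem_closedNbhd {A : Finset V} {u v : V} :
    u ∈ closedNbhd G A v ↔ u = v ∨ (u ∈ A ∧ G.Adj v u) := by
  simp [closedNbhd]

lemma isoSet_sdiff {A I : Finset V} (hI : I ⊆ isoSet G A) :
    isoSet G (A \ I) = isoSet G A \ I := by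
  ext u
  simp only [mem_isoSet, Finset.mem_sdiff]
  refine ⟨fun ⟨⟨hu, huI⟩, h⟩ => ⟨⟨hu, fun w hw huw => ?_⟩, huI⟩,
    fun ⟨⟨hu, h⟩, huI⟩ => ⟨⟨hu, huI⟩, fun w hw => h w hw.1⟩⟩
  by_cases hwI : w ∈ I
  · exact (mem_isoSet.1 (hI hwI)).2 u hu huw.symm
  · exact h w ⟨hw, hwI⟩ huw

/-- Isolated vertices may be credited to their owners and removed. -/
lemma scoreB_sdiff_of_subset_isoSet (turn : Bool) {A I : Finset V} (hI : I ⊆ isoSet G A) :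
    scoreB G color turn A = ∑ x ∈ I, vertexSign color x + scoreB G color turn (A \ I) := by
  have h : (A \ I) \ (isoSet G A \ I) = A \ isoSet G A := by
    ext u
    have := @hI u
    simp only [Finset.mem_sdiff]
    tauto
  rw [scoreB_eq, scoreB_eq G color turn (A \ I), isoSet_sdiff hI, h,
    ← Finset.sum_sdiff hI]
  ring

lemma scoreB_erase_of_isolated (turn : Bool) {A : Finset V} {v : V} (hv : v ∈ isoSet G A) :
    scoreB G color turn A = vertexSign color v + scoreB G color turn (A.erase v) := by
  rw [scoreB_sdiff_of_subset_isoSet turn (Finset.singleton_subset_iff.2 hv),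
    Finset.sum_singleton, Finset.sdiff_singleton_eq_erase]

lemma scoreB_empty (turn : Bool) : scoreB G color turn ∅ = 0 := by
  rw [scoreB_eq]
  simp [isoSet, bestMoveValue]

lemma scoreB_of_edgeless (turn : Bool) {A : Finset V} (h : ∀ u ∈ A, ∀ w ∈ A, ¬ G.Adj u w) :
    scoreB G color turn A = ∑ x ∈ A, vertexSign color x := by
  rw [scoreB_sdiff_of_subset_isoSet turn (I := A) fun u hu => mem_isoSet.2 ⟨hu, h u hu⟩]
  simp [scoreB_empty]

lemma mem_filter_sdiff_isoSet {turn : Bool} {A : Finset V} {v : V} :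
    v ∈ (A \ isoSet G A).filter (fun u => color u = turn) ↔
      v ∈ A ∧ (∃ w ∈ A, G.Adj v w) ∧ color v = turn := by
  simp only [Finset.mem_filter, Finset.mem_sdiff, mem_isoSet]
  grind

lemma closedNbhd_sdiff_isoSet {A : Finset V} {v : V} (hv : v ∈ A) :
    closedNbhd G (A \ isoSet G A) v = closedNbhd G A v := by
  ext u
  simp only [mem_closedNbhd, Finset.mem_sdiff, mem_isoSet]
  have := fun h : G.Adj v u => h.symm
  grind

omit [Fintype V] in
lemma closedNbhd_subset {A : Finset V} {v : V} (hv : v ∈ A) : closedNbhd G A v ⊆ A := by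
  intro u hu
  rcases mem_closedNbhd.1 hu with rfl | h
  exacts [hv, h.1]

/-- The same-coloured vertices that a move isolates may equally be credited after the move. -/
lemma scoreB_after_move (turn : Bool) {A : Finset V} {v : V} (hv : v ∈ A)
    (hne : ∃ w ∈ A, G.Adj v w) :
    ∑ x ∈ isoSet G A, vertexSign color x
        + (vertexSign color v * ((Rmv G color (A \ isoSet G A) v).card : ℝ)
          + scoreB G color turn ((A \ isoSet G A) \ Rmv G color (A \ isoSet G A) v)) =
      vertexSign color v * ((closedNbhd G A v).card : ℝ)
        + scoreB G color turn (A \ closedNbhd G A v) := by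
  set N := closedNbhd G A v with hN
  set R := Rmv G color (A \ isoSet G A) v with hR
  have hmem : ∀ u, u ∈ R ↔ u ∈ N ∨ ((u ∈ A ∧ u ∉ isoSet G A) ∧ color u = color v ∧
      ∀ w ∈ A, w ∉ isoSet G A → G.Adj u w → w ∈ N) := by
    intro u
    simp only [hR, Rmv, closedNbhd_sdiff_isoSet hv, ← hN, Finset.mem_union, Finset.mem_filter,
      Finset.mem_sdiff, and_imp]
  have hNR : N ⊆ R := fun u hu => (hmem u).2 (Or.inl hu)
  have hNiso : ∀ u ∈ N, u ∉ isoSet G A := by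
    intro u hu hi
    rw [mem_isoSet] at hi
    rcases mem_closedNbhd.1 hu with rfl | ⟨-, h⟩
    · obtain ⟨w, hw, h⟩ := hne
      exact hi.2 w hw h
    · exact hi.2 v hv h.symm
  have hdisj : Disjoint (isoSet G A) (R \ N) := by
    rw [Finset.disjoint_left]
    intro u hu huR
    rcases (hmem u).1 (Finset.mem_sdiff.1 huR).1 with h | h
    · exact (Finset.mem_sdiff.1 huR).2 h
    · exact h.1.2 hu
  have hsub : isoSet G A ∪ (R \ N) ⊆ isoSet G (A \ N) := by
    intro u hu
    simp only [mem_isoSet, Finset.mem_sdiff]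
    rcases Finset.mem_union.1 hu with h | h
    · exact ⟨⟨(mem_isoSet.1 h).1, fun hn => hNiso u hn h⟩,
        fun w hw => (mem_isoSet.1 h).2 w hw.1⟩
    · obtain ⟨hR', hnN⟩ := Finset.mem_sdiff.1 h
      rcases (hmem u).1 hR' with h' | ⟨⟨hA, -⟩, -, h'⟩
      · exact absurd h' hnN
      · refine ⟨⟨hA, hnN⟩, fun w hw huw => hw.2 (h' w hw.1 (fun hi => ?_) huw)⟩
        exact (mem_isoSet.1 hi).2 u hA huw.symm
  have hset : (A \ N) \ (isoSet G A ∪ (R \ N)) = (A \ isoSet G A) \ R := by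
    ext u
    have := @hNR u
    simp only [Finset.mem_sdiff, Finset.mem_union]
    tauto
  have hsum : ∑ x ∈ R \ N, vertexSign color x = vertexSign color v * ((R \ N).card : ℝ) := by
    rw [mul_comm, ← nsmul_eq_mul, ← Finset.sum_const]
    refine Finset.sum_congr rfl fun u hu => ?_
    obtain ⟨hR', hnN⟩ := Finset.mem_sdiff.1 hu
    rcases (hmem u).1 hR' with h' | ⟨-, h', -⟩
    · exact absurd h' hnN
    · simp only [vertexSign, h']
  have hcard : (R.card : ℝ) = ((R \ N).card : ℝ) + (N.card : ℝ) := by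
    exact_mod_cast (Finset.card_sdiff_add_card_eq_card hNR).symm
  rw [scoreB_sdiff_of_subset_isoSet turn hsub, Finset.sum_union hdisj, hsum, hset, hcard]
  ring

lemma le_scoreB_true {A : Finset V} {v w : V} (hv : v ∈ A) (hw : w ∈ A) (hvw : G.Adj v w)
    (hc : color v = true) :
    ((closedNbhd G A v).card : ℝ) + scoreB G color false (A \ closedNbhd G A v) ≤
      scoreB G color true A := by
  have hm := mem_filter_sdiff_isoSet.2 ⟨hv, ⟨w, hw, hvw⟩, hc⟩
  have key := scoreB_after_move (color := color) false hv ⟨w, hw, hvw⟩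
  simp only [vertexSign.eq_1 color v, hc, if_true, one_mul] at key
  rw [← key, scoreB_eq G color true A, bestMoveValue, dif_pos ⟨v, hm⟩, if_pos rfl]
  refine add_le_add_right ?_ _
  exact Finset.le_sup' (fun x : {x // x ∈ (A \ isoSet G A).filter (fun u => color u = true)} =>
    ((Rmv G color (A \ isoSet G A) x.1).card : ℝ) +
      scoreB G color false ((A \ isoSet G A) \ Rmv G color (A \ isoSet G A) x.1))
    (Finset.mem_attach _ ⟨v, hm⟩)

lemma scoreB_false_le {A : Finset V} {v w : V} (hv : v ∈ A) (hw : w ∈ A) (hvw : G.Adj v w)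
    (hc : color v = false) :
    scoreB G color false A ≤
      -((closedNbhd G A v).card : ℝ) + scoreB G color true (A \ closedNbhd G A v) := by
  have hm := mem_filter_sdiff_isoSet.2 ⟨hv, ⟨w, hw, hvw⟩, hc⟩
  have key := scoreB_after_move (color := color) true hv ⟨w, hw, hvw⟩
  simp only [vertexSign.eq_1 color v, hc, Bool.false_eq_true, if_false, neg_one_mul] at key
  rw [← key, scoreB_eq G color false A, bestMoveValue, dif_pos ⟨v, hm⟩,
    if_neg Bool.false_ne_true]
  refine add_le_add_right ?_ _
  exact Finset.inf'_le (fun x : {x // x ∈ (A \ isoSet G A).filter (fun u => color u = false)} =>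
    -((Rmv G color (A \ isoSet G A) x.1).card : ℝ) +
      scoreB G color true ((A \ isoSet G A) \ Rmv G color (A \ isoSet G A) x.1))
    (Finset.mem_attach _ ⟨v, hm⟩)

lemma exists_scoreB_true_eq {A : Finset V} {b c : V} (hb : b ∈ A) (hc : c ∈ A)
    (hbc : G.Adj b c) (hcol : color b = true) :
    ∃ v ∈ A, ∃ w ∈ A, G.Adj v w ∧ color v = true ∧ scoreB G color true A =
      ((closedNbhd G A v).card : ℝ) + scoreB G color false (A \ closedNbhd G A v) := by
  have hm : ((A \ isoSet G A).filter fun u => color u = true).Nonempty :=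
    ⟨b, mem_filter_sdiff_isoSet.2 ⟨hb, ⟨c, hc, hbc⟩, hcol⟩⟩
  obtain ⟨⟨v, hv⟩, -, hval⟩ := Finset.exists_mem_eq_sup' (Finset.attach_nonempty_iff.mpr hm)
    (fun x => ((Rmv G color (A \ isoSet G A) x.1).card : ℝ) +
      scoreB G color false ((A \ isoSet G A) \ Rmv G color (A \ isoSet G A) x.1))
  obtain ⟨hvA, ⟨w, hw, hvw⟩, hvc⟩ := mem_filter_sdiff_isoSet.1 hv
  have key := scoreB_after_move (color := color) false hvA ⟨w, hw, hvw⟩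
  simp only [vertexSign.eq_1 color v, hvc, if_true, one_mul] at key
  refine ⟨v, hvA, w, hw, hvw, hvc, ?_⟩
  rw [← key, scoreB_eq, bestMoveValue, dif_pos hm, if_pos rfl, hval]

lemma exists_scoreB_false_eq {A : Finset V} {b c : V} (hb : b ∈ A) (hc : c ∈ A)
    (hbc : G.Adj b c) (hcol : color b = false) :
    ∃ v ∈ A, ∃ w ∈ A, G.Adj v w ∧ color v = false ∧ scoreB G color false A =
      -((closedNbhd G A v).card : ℝ) + scoreB G color true (A \ closedNbhd G A v) := by
  have hm : ((A \ isoSet G A).filter fun u => color u = false).Nonempty :=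
    ⟨b, mem_filter_sdiff_isoSet.2 ⟨hb, ⟨c, hc, hbc⟩, hcol⟩⟩
  obtain ⟨⟨v, hv⟩, -, hval⟩ := Finset.exists_mem_eq_inf' (Finset.attach_nonempty_iff.mpr hm)
    (fun x => -((Rmv G color (A \ isoSet G A) x.1).card : ℝ) +
      scoreB G color true ((A \ isoSet G A) \ Rmv G color (A \ isoSet G A) x.1))
  obtain ⟨hvA, ⟨w, hw, hvw⟩, hvc⟩ := mem_filter_sdiff_isoSet.1 hv
  have key := scoreB_after_move (color := color) true hvA ⟨w, hw, hvw⟩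
  simp only [vertexSign.eq_1 color v, hvc, Bool.false_eq_true, if_false, neg_one_mul] at key
  refine ⟨v, hvA, w, hw, hvw, hvc, ?_⟩
  rw [← key, scoreB_eq, bestMoveValue, dif_pos hm, if_neg Bool.false_ne_true, hval]

/-- In a bipartite graph, a player without a move faces an edgeless position. -/
lemma edgeless_or_exists_move {color : V → Bool}
    (hbip : ∀ u v : V, G.Adj u v → color u ≠ color v) (turn : Bool) (A : Finset V) :
    (∀ u ∈ A, ∀ w ∈ A, ¬ G.Adj u w) ∨ ∃ u ∈ A, ∃ w ∈ A, G.Adj u w ∧ color u = turn := by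
  by_contra! h
  obtain ⟨⟨u, hu, w, hw, huw⟩, h⟩ := h
  have h1 := h u hu w hw huw
  have h2 := h w hw u hu huw.symm
  have h3 := hbip u w huw
  revert h1 h2 h3
  cases color u <;> cases color w <;> cases turn <;> simp

/-- Swapping the colours negates the score. -/
lemma scoreB_swap {color : V → Bool} (hbip : ∀ u v : V, G.Adj u v → color u ≠ color v)
    (A : Finset V) (turn : Bool) :
    scoreB G (fun v => !color v) (!turn) A = -scoreB G color turn A := by
  have hsign : ∀ v, vertexSign (fun v => !color v) v = -vertexSign color v := by
    intro v
    cases h : color v <;> simp [vertexSign, h]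
  have hlt : ∀ {A : Finset V} {v : V}, v ∈ A → (A \ closedNbhd G A v).card < A.card := by
    intro A v hv
    refine Finset.card_lt_card (Finset.sdiff_ssubset (closedNbhd_subset hv) ⟨v, ?_⟩)
    exact mem_closedNbhd.2 (Or.inl rfl)
  induction hn : A.card using Nat.strong_induction_on generalizing A turn with
  | _ n ih =>
  subst hn
  rcases edgeless_or_exists_move hbip turn A with he | ⟨b, hb, c, hc, hbc, hcol⟩
  · rw [scoreB_of_edgeless _ he, scoreB_of_edgeless _ he, ← Finset.sum_neg_distrib]
    exact Finset.sum_congr rfl fun v _ => hsign v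
  cases turn with
  | true =>
    obtain ⟨v, hv, w, hw, hvw, hvc, h1⟩ := exists_scoreB_true_eq hb hc hbc hcol
    obtain ⟨v', hv', w', hw', hvw', hvc', h2⟩ :=
      exists_scoreB_false_eq (color := fun v => !color v) hb hc hbc (by simp [hcol])
    have h3 := le_scoreB_true (color := color) hv' hw' hvw' (by simpa using hvc')
    have h4 := scoreB_false_le (color := fun v => !color v) hv hw hvw (by simp [hvc])
    have i1 := ih _ (hlt hv) _ false rfl
    have i2 := ih _ (hlt hv') _ false rfl
    simp only [Bool.not_false, Bool.not_true] at *
    linarith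
  | false =>
    obtain ⟨v, hv, w, hw, hvw, hvc, h1⟩ := exists_scoreB_false_eq hb hc hbc hcol
    obtain ⟨v', hv', w', hw', hvw', hvc', h2⟩ :=
      exists_scoreB_true_eq (color := fun v => !color v) hb hc hbc (by simp [hcol])
    have h3 := scoreB_false_le (color := color) hv' hw' hvw' (by simpa using hvc')
    have h4 := le_scoreB_true (color := fun v => !color v) hv hw hvw (by simp [hvc])
    have i1 := ih _ (hlt hv) _ true rfl
    have i2 := ih _ (hlt hv') _ true rfl
    simp only [Bool.not_false, Bool.not_true] at *
    linarith

lemma scoreB_le_sdiff_of_erase {n : ℕ}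
    (h : ∀ A : Finset V, A.card ≤ n → ∀ w, color w = false → ∀ turn,
      scoreB G color turn A ≤ scoreB G color turn (A.erase w) + 1)
    {A : Finset V} (hA : A.card ≤ n) (turn : Bool) (W : Finset V)
    (hW : ∀ w ∈ W, color w = false) :
    scoreB G color turn A ≤ scoreB G color turn (A \ W) + (W.card : ℝ) := by
  induction W using Finset.induction_on with
  | empty => simp
  | insert w W hw ih =>
    have h1 := ih fun u hu => hW u (Finset.mem_insert_of_mem hu)
    have h2 := h (A \ W) ((Finset.card_le_card Finset.sdiff_subset).trans hA) w
      (hW w (Finset.mem_insert_self _ _)) turn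
    rw [Finset.card_insert_of_notMem hw, Finset.sdiff_insert]
    push_cast
    linarith

/-- Moving is never worse than passing, provided that giving away white vertices is cheap. -/
lemma scoreB_false_le_true {color : V → Bool} {n : ℕ}
    (hbip : ∀ u v : V, G.Adj u v → color u ≠ color v)
    (h : ∀ A : Finset V, A.card ≤ n → ∀ w, color w = false → ∀ turn,
      scoreB G color turn A ≤ scoreB G color turn (A.erase w) + 1)
    {A : Finset V} (hA : A.card ≤ n) :
    scoreB G color false A ≤ scoreB G color true A := by
  rcases edgeless_or_exists_move hbip true A with he | ⟨v, hv, w, hw, hvw, hc⟩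
  · rw [scoreB_of_edgeless _ he, scoreB_of_edgeless _ he]
  set W := A.filter fun u => G.Adj v u with hWdef
  have hvW : v ∉ W := by simp [hWdef]
  have h1 := scoreB_le_sdiff_of_erase h hA false W (by
    intro u hu
    have := hbip v u (Finset.mem_filter.1 hu).2
    simpa [hc] using this.symm)
  have h2 := le_scoreB_true hv hw hvw hc
  have h3 := scoreB_erase_of_isolated (G := G) (color := color) false (A := A \ W) (v := v)
    (mem_isoSet.2 ⟨by simp [hv, hvW], by
      simp only [hWdef, Finset.mem_sdiff, Finset.mem_filter]
      tauto⟩)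
  have h4 : (A \ W).erase v = A \ closedNbhd G A v := by
    rw [closedNbhd, Finset.sdiff_insert]
  have h5 : (closedNbhd G A v).card = W.card + 1 := Finset.card_insert_of_notMem hvW
  rw [h4] at h3
  rw [h5] at h2
  simp only [vertexSign, hc, if_true] at h3
  push_cast at h2
  linarith

/-- Giving away one white vertex costs Right at most one point. -/
lemma scoreB_le_erase {color : V → Bool} (hbip : ∀ u v : V, G.Adj u v → color u ≠ color v)
    (A : Finset V) (w : V) (hw : color w = false) (turn : Bool) :
    scoreB G color turn A ≤ scoreB G color turn (A.erase w) + 1 := by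
  induction hn : A.card using Nat.strong_induction_on generalizing A w turn with
  | _ n ih =>
  subst hn
  by_cases hwA : w ∉ A
  · rw [Finset.erase_eq_of_notMem hwA]
    linarith
  rw [not_not] at hwA
  by_cases hiso : w ∈ isoSet G A
  · rw [scoreB_erase_of_isolated turn hiso]
    simp only [vertexSign, hw]
    norm_num
    linarith
  obtain ⟨b, hb, hwb⟩ : ∃ b ∈ A, G.Adj w b := by
    by_contra! h
    exact hiso (mem_isoSet.2 ⟨hwA, h⟩)
  have hlt : ∀ v ∈ A, (A \ closedNbhd G A v).card < A.card := fun v hv =>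
    Finset.card_lt_card (Finset.sdiff_ssubset (closedNbhd_subset hv)
      ⟨v, mem_closedNbhd.2 (Or.inl rfl)⟩)
  have hnbhd : ∀ v, v ≠ w → ¬ G.Adj v w →
      closedNbhd G (A.erase w) v = closedNbhd G A v := by
    intro v hne hvw
    ext u
    simp only [mem_closedNbhd, Finset.mem_erase]
    grind
  cases turn with
  | true =>
    have hbc : color b = true := by
      have := hbip w b hwb
      rw [hw] at this
      simpa using this.symm
    obtain ⟨v, hv, x, hx, hvx, hvc, hval⟩ := exists_scoreB_true_eq hb hwA hwb.symm hbc
    have hvw : v ≠ w := by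
      rintro rfl
      simp [hw] at hvc
    have hv' : v ∈ A.erase w := Finset.mem_erase.2 ⟨hvw, hv⟩
    by_cases hmove : ∃ y ∈ A.erase w, G.Adj v y
    · obtain ⟨y, hy, hvy⟩ := hmove
      have h1 := le_scoreB_true hv' hy hvy hvc
      by_cases hadj : G.Adj v w
      · have hN : closedNbhd G A v = insert w (closedNbhd G (A.erase w) v) := by
          ext u
          simp only [mem_closedNbhd, Finset.mem_erase, Finset.mem_insert]
          grind
        have hwN : w ∉ closedNbhd G (A.erase w) v := by
          simp [mem_closedNbhd, hvw.symm]
        have hrest : A.erase w \ closedNbhd G (A.erase w) v = A \ closedNbhd G A v := by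
          rw [hN, Finset.sdiff_insert, Finset.erase_sdiff_comm]
        rw [hrest] at h1
        rw [hval, hN, Finset.card_insert_of_notMem hwN, ← hN]
        push_cast
        linarith
      · rw [hnbhd v hvw hadj, Finset.erase_sdiff_comm] at h1
        have h2 := ih _ (hlt v hv) _ w hw false rfl
        linarith
    · push Not at hmove
      have hxw : x = w := by
        by_contra hne
        exact hmove x (Finset.mem_erase.2 ⟨hne, hx⟩) hvx
      subst hxw
      have hN : closedNbhd G A v = {v, x} := by
        ext u
        simp only [mem_closedNbhd, Finset.mem_insert, Finset.mem_singleton]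
        have := hmove u
        simp only [Finset.mem_erase] at this
        grind
      have hrest : (A.erase x).erase v = A \ closedNbhd G A v := by
        rw [hN, Finset.sdiff_insert, Finset.sdiff_singleton_eq_erase]
      have h1 := scoreB_erase_of_isolated (color := color) true (mem_isoSet.2 ⟨hv', hmove⟩)
      have h2 := scoreB_false_le_true (n := (A \ closedNbhd G A v).card) hbip
        (fun A' hA' w' hw' t => ih _ (hA'.trans_lt (hlt v hv)) A' w' hw' t rfl) le_rfl
      have h3 : (closedNbhd G A v).card = 2 := by rw [hN, Finset.card_pair hvw]
      rw [hrest] at h1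
      rw [h3] at hval
      simp only [vertexSign, hvc, if_true] at h1
      push_cast at hval
      linarith
  | false =>
    rcases edgeless_or_exists_move hbip false (A.erase w) with he | ⟨u, hu, x, hx, hux, huc⟩
    · have hsub : A \ closedNbhd G A w ⊆ A.erase w := by
        rw [closedNbhd, Finset.sdiff_insert]
        exact Finset.erase_subset_erase _ Finset.sdiff_subset
      have h1 := scoreB_false_le hwA hb hwb hw
      rw [scoreB_of_edgeless (A := A \ closedNbhd G A w) _
        fun u hu x hx => he u (hsub hu) x (hsub hx)] at h1
      rw [scoreB_of_edgeless _ he, ← Finset.sum_sdiff hsub]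
      have h2 := neg_card_le_sum_vertexSign color (A.erase w \ (A \ closedNbhd G A w))
      have h3 : (((A.erase w \ (A \ closedNbhd G A w)).card : ℕ) : ℝ) ≤
          ((closedNbhd G A w).card : ℝ) := by
        refine Nat.cast_le.2 (Finset.card_le_card fun u hu => ?_)
        simp only [Finset.mem_sdiff, Finset.mem_erase] at hu
        tauto
      linarith
    · obtain ⟨v, hv, y, hy, hvy, hvc, hval⟩ := exists_scoreB_false_eq hu hx hux huc
      obtain ⟨hvw, hvA⟩ := Finset.mem_erase.1 hv
      have hadj : ¬ G.Adj v w := fun h => hbip v w h (hvc.trans hw.symm)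
      rw [hnbhd v hvw hadj, Finset.erase_sdiff_comm] at hval
      have h1 := scoreB_false_le hvA (Finset.mem_of_mem_erase hy) hvy hvc
      have h2 := ih _ (hlt v hvA) _ w hw true rfl
      linarith

lemma scoreB_le_sdiff {color : V → Bool} (hbip : ∀ u v : V, G.Adj u v → color u ≠ color v)
    (A W : Finset V) (hW : ∀ w ∈ W, color w = false) (turn : Bool) :
    scoreB G color turn A ≤ scoreB G color turn (A \ W) + (W.card : ℝ) :=
  scoreB_le_sdiff_of_erase (fun A _ w hw t => scoreB_le_erase hbip A w hw t) le_rfl turn W hW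

lemma scoreB_sdiff_le {color : V → Bool} (hbip : ∀ u v : V, G.Adj u v → color u ≠ color v)
    (A B : Finset V) (hB : ∀ b ∈ B, color b = true) (turn : Bool) :
    scoreB G color turn (A \ B) - (B.card : ℝ) ≤ scoreB G color turn A := by
  have h := scoreB_le_sdiff (G := G) (color := fun v => !color v)
    (fun u v huv => by simpa using hbip u v huv) A B (fun b hb => by simp [hB b hb]) (!turn)
  rw [scoreB_swap hbip, scoreB_swap hbip] at h
  linarith

end Influence

/-- Giving away a set of black (`B₀`) or white (`W₀`) vertices changes the
scores of Bipartite Influence by at most the number of removed vertices: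
(1) `Ls(G) ≤ Ls(G\W₀) + |W₀|`, (2) `Rs(G) ≥ Rs(G\B₀) − |B₀|`,
(3) `Ls(G) ≥ Ls(G\B₀) − |B₀|`, (4) `Rs(G) ≤ Rs(G\W₀) + |W₀|`. -/
theorem influence_remove_vertices {V : Type} [Fintype V] [DecidableEq V]
    (G : SimpleGraph V) [DecidableRel G.Adj] (color : V → Bool)
    (hbip : ∀ u v : V, G.Adj u v → color u ≠ color v)
    (B₀ W₀ : Finset V)
    (hB₀ : ∀ v ∈ B₀, color v = true) (hW₀ : ∀ v ∈ W₀, color v = false) :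
    scoreB G color true Finset.univ ≤
        scoreB G color true (Finset.univ \ W₀) + (W₀.card : ℝ) ∧
    scoreB G color false (Finset.univ \ B₀) - (B₀.card : ℝ) ≤
        scoreB G color false Finset.univ ∧
    scoreB G color true (Finset.univ \ B₀) - (B₀.card : ℝ) ≤
        scoreB G color true Finset.univ ∧
    scoreB G color false Finset.univ ≤
        scoreB G color false (Finset.univ \ W₀) + (W₀.card : ℝ) := by
  exact ⟨scoreB_le_sdiff hbip _ _ hW₀ _, scoreB_sdiff_le hbip _ _ hB₀ _,
    scoreB_sdiff_le hbip _ _ hB₀ _, scoreB_le_sdiff hbip _ _ hW₀ _⟩
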